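/- Assume d(n)/n → 0. Define h₁(n) = √(1 − (r₁ d (ln(n/d))^{3/2}/n)^{2/(d−1)}) and h₂(n) = √(1 − (r₂ d/n)^{2(d+1)/(d−1)²}) (well defined for n/d large enough). Then there exist positive constants r₁ (sufficiently large) and r₂ (sufficiently small) such that F(n,d,−1,h₁(n)) → 0 and F(n,d,h₂(n),1) → 0 as n → ∞; consequently F(n,d,−1,1) − F(n,d,h₁(n),h₂(n)) → 0. -/

import Mathlib

open Filter

noncomputable def c1 (d : ℕ) : ℝ :=
  Real.Gamma ((d : ℝ) / 2) / (Real.sqrt Real.pi * Real.Gamma (((d : ℝ) - 1) / 2))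

noncomputable def c2 (d : ℕ) : ℝ :=
  Real.Gamma (((d : ℝ) ^ 2 - 2 * (d : ℝ) + 2) / 2) /
    (Real.sqrt Real.pi * Real.Gamma (((d : ℝ) ^ 2 - 2 * (d : ℝ) + 1) / 2))

/-- `II n d a b` is the integral `I(n,d,a,b)` from the paper. -/
noncomputable def II (n d : ℕ) (a b : ℝ) : ℝ :=
  ∫ h in a..b, (1 - h ^ 2) ^ (((d : ℝ) ^ 2 - 2 * (d : ℝ) - 1) / 2) *
    (c1 d * ∫ s in (-1 : ℝ)..h, (1 - s ^ 2) ^ (((d : ℝ) - 3) / 2)) ^ (n - d)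

/-- `FF n d a b` is the expected number of facets with height in `[a,b]`. -/
noncomputable def FF (n d : ℕ) (a b : ℝ) : ℝ :=
  (n.choose d : ℝ) * 2 * c2 d * II n d a b

/-- The standard normal CDF. -/
noncomputable def stdPhi (r : ℝ) : ℝ :=
  (Real.sqrt (2 * Real.pi))⁻¹ * ∫ s in Set.Iic r, Real.exp (-s ^ 2 / 2)

open MeasureTheory intervalIntegral Set

lemma ofReal_beta_integrand {a x : ℝ} (hx : x ∈ Icc (0 : ℝ) 1) :
    (x : ℂ) ^ ((a : ℂ) - 1) * (1 - (x : ℂ)) ^ ((a : ℂ) - 1) =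
      ((x ^ (a - 1) * (1 - x) ^ (a - 1) : ℝ) : ℂ) := by
  rw [Complex.ofReal_mul, Complex.ofReal_cpow hx.1, Complex.ofReal_cpow (by linarith [hx.2])]
  push_cast
  rfl

lemma intervalIntegrable_beta_integrand {a : ℝ} (ha : 0 < a) :
    IntervalIntegrable (fun x : ℝ => x ^ (a - 1) * (1 - x) ^ (a - 1)) volume 0 1 := by
  have h := Complex.betaIntegral_convergent (u := (a : ℂ)) (v := (a : ℂ)) (by simpa) (by simpa)
  have h2 := (h.1).re
  rw [intervalIntegrable_iff_integrableOn_Ioc_of_le zero_le_one]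
  refine h2.congr ?_
  filter_upwards [ae_restrict_mem measurableSet_Ioc] with x hx
  rw [ofReal_beta_integrand (Ioc_subset_Icc_self hx)]
  simp

lemma integral_beta_integrand {a : ℝ} (ha : 0 < a) :
    ∫ x in (0 : ℝ)..1, x ^ (a - 1) * (1 - x) ^ (a - 1) =
      Real.Gamma a * Real.Gamma a / Real.Gamma (a + a) := by
  have h : ((∫ x in (0 : ℝ)..1, x ^ (a - 1) * (1 - x) ^ (a - 1) : ℝ) : ℂ) =
      Complex.betaIntegral a a := by
    rw [Complex.betaIntegral, ← intervalIntegral.integral_ofReal]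
    refine intervalIntegral.integral_congr fun x hx => ?_
    rw [uIcc_of_le zero_le_one] at hx
    exact (ofReal_beta_integrand hx).symm
  have h2 := ProbabilityTheory.beta_eq_betaIntegralReal a a ha ha
  rw [← h, Complex.ofReal_re] at h2
  exact h2.symm

lemma one_sub_sq_rpow_eq {a s : ℝ} (hs : s ∈ Icc (-1 : ℝ) 1) :
    (1 - s ^ 2) ^ (a - 1) = 4 ^ (a - 1) *
      ((2⁻¹ * s + 2⁻¹) ^ (a - 1) * (1 - (2⁻¹ * s + 2⁻¹)) ^ (a - 1)) := by
  rw [← Real.mul_rpow (by linarith [hs.1]) (by linarith [hs.2]),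
    ← Real.mul_rpow (by norm_num) (mul_nonneg (by linarith [hs.1]) (by linarith [hs.2]))]
  congr 1
  ring

lemma intervalIntegrable_one_sub_sq_rpow {p : ℝ} (hp : -1 < p) :
    IntervalIntegrable (fun s : ℝ => (1 - s ^ 2) ^ p) volume (-1) 1 := by
  have h := ((intervalIntegrable_beta_integrand (a := p + 1) (by linarith)).comp_add_right
    2⁻¹).comp_mul_left (c := 2⁻¹)
  norm_num at h
  refine (h.const_mul (4 ^ p)).congr fun s hs => ?_
  rw [uIoc_of_le (by norm_num)] at hs
  have := one_sub_sq_rpow_eq (a := p + 1) (Ioc_subset_Icc_self hs)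
  norm_num at this
  simp only [this]

lemma integral_one_sub_sq_rpow {a : ℝ} (ha : 0 < a) :
    ∫ s in (-1 : ℝ)..1, (1 - s ^ 2) ^ (a - 1) =
      √Real.pi * Real.Gamma a / Real.Gamma (a + 1 / 2) := by
  have h1 : ∫ s in (-1 : ℝ)..1, (1 - s ^ 2) ^ (a - 1) = ∫ s in (-1 : ℝ)..1, 4 ^ (a - 1) *
      ((2⁻¹ * s + 2⁻¹) ^ (a - 1) * (1 - (2⁻¹ * s + 2⁻¹)) ^ (a - 1)) := by
    refine intervalIntegral.integral_congr fun s hs => ?_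
    rw [uIcc_of_le (by norm_num)] at hs
    exact one_sub_sq_rpow_eq hs
  rw [h1, intervalIntegral.integral_const_mul,
    intervalIntegral.integral_comp_mul_add
      (fun x => x ^ (a - 1) * (1 - x) ^ (a - 1)) (by norm_num) (2⁻¹ : ℝ)]
  norm_num
  rw [integral_beta_integrand ha]
  have h2 := Real.Gamma_mul_Gamma_add_half a
  have hG := Real.Gamma_pos_of_pos ha
  have hG2 : 0 < Real.Gamma (a + 1 / 2) := Real.Gamma_pos_of_pos (by linarith)
  have hG3 : 0 < Real.Gamma (2 * a) := Real.Gamma_pos_of_pos (by linarith)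
  rw [← two_mul]
  have h4 : (4 : ℝ) ^ (a - 1) * 2 * (2 : ℝ) ^ (1 - 2 * a) = 1 := by
    rw [show (4 : ℝ) = 2 ^ (2 : ℝ) by norm_num, ← Real.rpow_mul (by norm_num),
      mul_right_comm, ← Real.rpow_add (by norm_num),
      show 2 * (a - 1) + (1 - 2 * a) = (-1 : ℝ) by ring, Real.rpow_neg_one]
    norm_num
  generalize Real.Gamma (2 * a) = G at *
  generalize Real.Gamma (a + 1 / 2) = H at *
  generalize (2 : ℝ) ^ (1 - 2 * a) = w at *
  field_simp
  linear_combination (4 ^ (a - 1) * 2) * h2 + G * √Real.pi * h4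

lemma Gamma_add_half_sq_le {x : ℝ} (hx : 0 < x) :
    Real.Gamma (x + 1 / 2) ^ 2 ≤ x * Real.Gamma x ^ 2 := by
  have h := Real.Gamma_mul_add_mul_le_rpow_Gamma_mul_rpow_Gamma hx (by linarith : 0 < x + 1)
    (by norm_num : (0 : ℝ) < 1 / 2) (by norm_num : (0 : ℝ) < 1 / 2) (by norm_num)
  rw [show 1 / 2 * x + 1 / 2 * (x + 1) = x + 1 / 2 by ring, Real.Gamma_add_one hx.ne',
    ← Real.sqrt_eq_rpow, ← Real.sqrt_eq_rpow] at h
  have hG := Real.Gamma_pos_of_pos hx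
  have hG2 : 0 < Real.Gamma (x + 1 / 2) := Real.Gamma_pos_of_pos (by linarith)
  calc _ ≤ (√(Real.Gamma x) * √(x * Real.Gamma x)) ^ 2 := by gcongr
    _ = _ := by
      rw [mul_pow, Real.sq_sqrt hG.le, Real.sq_sqrt (by positivity)]
      ring

lemma sqrt_half_mul_Gamma_le {x : ℝ} (hx : 1 / 2 ≤ x) :
    √(x / 2) * Real.Gamma x ≤ Real.Gamma (x + 1 / 2) := by
  have hG := Real.Gamma_pos_of_pos (by linarith : 0 < x)
  have hG2 : 0 < Real.Gamma (x + 1 / 2) := Real.Gamma_pos_of_pos (by linarith)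
  have h := Gamma_add_half_sq_le (by linarith : 0 < x + 1 / 2)
  rw [show x + 1 / 2 + 1 / 2 = x + 1 by ring, Real.Gamma_add_one (by linarith)] at h
  refine abs_le_of_sq_le_sq' ?_ hG2.le |>.2
  rw [mul_pow, Real.sq_sqrt (by linarith)]
  have : x * (x * Real.Gamma x ^ 2) ≤ x * (2 * Real.Gamma (x + 1 / 2) ^ 2) := by
    nlinarith [sq_nonneg (Real.Gamma (x + 1 / 2))]
  have := le_of_mul_le_mul_left this (by linarith)
  linarith

lemma c1_mul_integral {d : ℕ} (hd : 2 ≤ d) :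
    c1 d * ∫ s in (-1 : ℝ)..1, (1 - s ^ 2) ^ (((d : ℝ) - 3) / 2) = 1 := by
  have hd' : (2 : ℝ) ≤ d := by exact_mod_cast hd
  rw [show ((d : ℝ) - 3) / 2 = ((d : ℝ) - 1) / 2 - 1 by ring,
    integral_one_sub_sq_rpow (by linarith), c1,
    show ((d : ℝ) - 1) / 2 + 1 / 2 = d / 2 by ring]
  have h1 := Real.Gamma_pos_of_pos (show 0 < ((d : ℝ) - 1) / 2 by linarith)
  have h2 := Real.Gamma_pos_of_pos (show 0 < (d : ℝ) / 2 by linarith)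
  field_simp

lemma c2_mul_integral {d : ℕ} (hd : 2 ≤ d) :
    c2 d * ∫ h in (-1 : ℝ)..1, (1 - h ^ 2) ^ (((d : ℝ) ^ 2 - 2 * (d : ℝ) - 1) / 2) = 1 := by
  have hd' : (2 : ℝ) ≤ d := by exact_mod_cast hd
  have hx : 0 < ((d : ℝ) ^ 2 - 2 * (d : ℝ) + 1) / 2 := by nlinarith
  rw [show ((d : ℝ) ^ 2 - 2 * (d : ℝ) - 1) / 2 = ((d : ℝ) ^ 2 - 2 * (d : ℝ) + 1) / 2 - 1 by ring,
    integral_one_sub_sq_rpow hx, c2,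
    show ((d : ℝ) ^ 2 - 2 * (d : ℝ) + 1) / 2 + 1 / 2 = ((d : ℝ) ^ 2 - 2 * (d : ℝ) + 2) / 2 by ring]
  have h1 := Real.Gamma_pos_of_pos hx
  have h2 := Real.Gamma_pos_of_pos (show 0 < ((d : ℝ) ^ 2 - 2 * (d : ℝ) + 2) / 2 by linarith)
  generalize Real.Gamma (((d : ℝ) ^ 2 - 2 * (d : ℝ) + 1) / 2) = G at *
  generalize Real.Gamma (((d : ℝ) ^ 2 - 2 * (d : ℝ) + 2) / 2) = H at *
  field_simp

lemma c2_pos {d : ℕ} (hd : 2 ≤ d) : 0 < c2 d := by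
  have hd' : (2 : ℝ) ≤ d := by exact_mod_cast hd
  have hx : 0 < ((d : ℝ) ^ 2 - 2 * (d : ℝ) + 1) / 2 := by nlinarith
  have h1 := Real.Gamma_pos_of_pos hx
  have h2 := Real.Gamma_pos_of_pos (show 0 < ((d : ℝ) ^ 2 - 2 * (d : ℝ) + 2) / 2 by linarith)
  rw [c2]
  positivity

lemma sqrt_le_c1 {d : ℕ} (hd : 2 ≤ d) : √((d : ℝ) - 1) / 4 ≤ c1 d := by
  have hd' : (2 : ℝ) ≤ d := by exact_mod_cast hd
  have h := sqrt_half_mul_Gamma_le (x := ((d : ℝ) - 1) / 2) (by linarith)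
  rw [show ((d : ℝ) - 1) / 2 + 1 / 2 = d / 2 by ring] at h
  have h1 := Real.Gamma_pos_of_pos (show 0 < ((d : ℝ) - 1) / 2 by linarith)
  have hpi : √Real.pi ≤ 2 := by
    rw [Real.sqrt_le_left (by norm_num)]
    linarith [Real.pi_le_four]
  have h4 : √(((d : ℝ) - 1) / 2 / 2) = √((d : ℝ) - 1) / 2 := by
    rw [show ((d : ℝ) - 1) / 2 / 2 = (d - 1) / 2 ^ 2 by ring, Real.sqrt_div' _ (by norm_num),
      Real.sqrt_sq (by norm_num)]
  rw [h4] at h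
  rw [c1, le_div_iff₀ (by positivity)]
  refine le_trans ?_ h
  calc √((d : ℝ) - 1) / 4 * (√Real.pi * Real.Gamma (((d : ℝ) - 1) / 2))
      ≤ √((d : ℝ) - 1) / 4 * (2 * Real.Gamma (((d : ℝ) - 1) / 2)) := by gcongr
    _ = _ := by ring

lemma c1_pos {d : ℕ} (hd : 2 ≤ d) : 0 < c1 d := by
  have hd' : (2 : ℝ) ≤ d := by exact_mod_cast hd
  have : 0 < √((d : ℝ) - 1) := Real.sqrt_pos.2 (by linarith)
  linarith [sqrt_le_c1 hd]

lemma c2_le {d : ℕ} (hd : 2 ≤ d) : c2 d ≤ d := by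
  have hd' : (2 : ℝ) ≤ d := by exact_mod_cast hd
  have hx : 0 < ((d : ℝ) ^ 2 - 2 * (d : ℝ) + 1) / 2 := by nlinarith
  have h := Gamma_add_half_sq_le hx
  rw [show ((d : ℝ) ^ 2 - 2 * (d : ℝ) + 1) / 2 + 1 / 2 =
    ((d : ℝ) ^ 2 - 2 * (d : ℝ) + 2) / 2 by ring] at h
  have h1 := Real.Gamma_pos_of_pos hx
  have hpi : 1 ≤ √Real.pi := by
    rw [Real.one_le_sqrt]
    linarith [Real.pi_gt_three]
  rw [c2, div_le_iff₀ (by positivity)]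
  generalize Real.Gamma (((d : ℝ) ^ 2 - 2 * (d : ℝ) + 1) / 2) = G at *
  have h2 : Real.Gamma (((d : ℝ) ^ 2 - 2 * (d : ℝ) + 2) / 2) ≤ d * G := by
    refine abs_le_of_sq_le_sq' (h.trans ?_) (by positivity) |>.2
    rw [mul_pow]
    gcongr
    nlinarith
  refine h2.trans ?_
  gcongr
  nlinarith

lemma integral_mul_one_sub_sq_rpow {x a b : ℝ} (hx : 0 < x) (ha : 0 ≤ a) (hab : a ≤ b)
    (hb : b ≤ 1) :
    ∫ s in a..b, s * (1 - s ^ 2) ^ (x - 1) = ((1 - a ^ 2) ^ x - (1 - b ^ 2) ^ x) / (2 * x) := by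
  have hint : IntervalIntegrable (fun s : ℝ => s * (1 - s ^ 2) ^ (x - 1)) volume a b := by
    refine IntervalIntegrable.mono_set (a := -1) (b := 1) ?_ ?_
    · exact (intervalIntegrable_one_sub_sq_rpow (by linarith)).continuousOn_mul (by fun_prop)
    · rw [uIcc_of_le hab, uIcc_of_le (by norm_num)]
      exact Icc_subset_Icc (by linarith) hb
  have := intervalIntegral.integral_eq_sub_of_hasDerivAt_of_le hab
    (f := fun s : ℝ => -(1 - s ^ 2) ^ x / (2 * x)) ?_ ?_ hint
  · rw [this]
    ring
  · refine ContinuousOn.div_const (ContinuousOn.neg ?_) _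
    exact ContinuousOn.rpow_const (by fun_prop) fun _ _ => Or.inr hx.le
  · intro s hs
    have h0 : 0 < 1 - s ^ 2 := by nlinarith [hs.1, hs.2]
    have h1 : HasDerivAt (fun s : ℝ => 1 - s ^ 2) (-(2 * s)) s := by
      simpa using (hasDerivAt_pow 2 s).const_sub 1
    convert! ((h1.rpow_const (p := x) (Or.inl h0.ne')).neg.div_const (2 * x)) using 1
    field_simp

lemma integral_one_sub_sq_rpow_le {x h : ℝ} (hx : 0 < x) (h0 : 0 < h) (h1 : h ≤ 1) :
    ∫ s in h..1, (1 - s ^ 2) ^ (x - 1) ≤ (1 - h ^ 2) ^ x / (2 * x * h) := by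
  have hint : IntervalIntegrable (fun s : ℝ => (1 - s ^ 2) ^ (x - 1)) volume h 1 := by
    refine IntervalIntegrable.mono_set (intervalIntegrable_one_sub_sq_rpow (by linarith)) ?_
    rw [uIcc_of_le h1, uIcc_of_le (by norm_num)]
    exact Icc_subset_Icc (by linarith) le_rfl
  have key := integral_mul_one_sub_sq_rpow hx h0.le h1 le_rfl
  rw [one_pow, sub_self, Real.zero_rpow hx.ne', sub_zero] at key
  have : ∫ s in h..1, h * (1 - s ^ 2) ^ (x - 1) ≤ ∫ s in h..1, s * (1 - s ^ 2) ^ (x - 1) := by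
    refine intervalIntegral.integral_mono_on h1 (hint.const_mul h)
      (hint.continuousOn_mul (by fun_prop)) fun s hs => ?_
    have : 0 ≤ 1 - s ^ 2 := by nlinarith [hs.1, hs.2]
    have := hs.1
    gcongr
  rw [intervalIntegral.integral_const_mul, key] at this
  rw [le_div_iff₀ (by positivity)]
  rw [le_div_iff₀ (by positivity)] at this
  linarith

lemma le_integral_one_sub_sq_rpow {x h k : ℝ} (hx : 0 < x) (h0 : 0 ≤ h) (hk : h ≤ k)
    (hk0 : 0 < k) (hk1 : k ≤ 1) :
    ((1 - h ^ 2) ^ x - (1 - k ^ 2) ^ x) / (2 * x * k) ≤ ∫ s in h..1, (1 - s ^ 2) ^ (x - 1) := by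
  have hint : IntervalIntegrable (fun s : ℝ => (1 - s ^ 2) ^ (x - 1)) volume h 1 := by
    refine IntervalIntegrable.mono_set (intervalIntegrable_one_sub_sq_rpow (by linarith)) ?_
    rw [uIcc_of_le (hk.trans hk1), uIcc_of_le (by norm_num)]
    exact Icc_subset_Icc (by linarith) le_rfl
  have hint' : IntervalIntegrable (fun s : ℝ => (1 - s ^ 2) ^ (x - 1)) volume h k := by
    refine hint.mono_set ?_
    rw [uIcc_of_le (hk.trans hk1), uIcc_of_le hk]
    exact Icc_subset_Icc le_rfl hk1
  have key := integral_mul_one_sub_sq_rpow hx h0 hk hk1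
  have h2 : ∫ s in h..k, s * (1 - s ^ 2) ^ (x - 1) ≤ ∫ s in h..k, k * (1 - s ^ 2) ^ (x - 1) := by
    refine intervalIntegral.integral_mono_on hk
      (hint'.continuousOn_mul (by fun_prop)) (hint'.const_mul k) fun s hs => ?_
    have : 0 ≤ 1 - s ^ 2 := by nlinarith [hs.1, hs.2]
    have := hs.2
    gcongr
  have h3 : ∫ s in h..k, (1 - s ^ 2) ^ (x - 1) ≤ ∫ s in h..1, (1 - s ^ 2) ^ (x - 1) := by
    refine intervalIntegral.integral_mono_interval le_rfl hk hk1 ?_ hint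
    filter_upwards [ae_restrict_mem measurableSet_Ioc] with s hs
    have : 0 ≤ 1 - s ^ 2 := by nlinarith [hs.1, hs.2]
    exact Real.rpow_nonneg this _
  rw [intervalIntegral.integral_const_mul, key] at h2
  refine le_trans ?_ h3
  rw [div_le_iff₀ (by positivity)]
  rw [div_le_iff₀ (by positivity)] at h2
  linarith

/-- The distribution function of one coordinate of a uniform random point on the unit sphere. -/
noncomputable def coordCdf (d : ℕ) (h : ℝ) : ℝ :=
  c1 d * ∫ s in (-1 : ℝ)..h, (1 - s ^ 2) ^ (((d : ℝ) - 3) / 2)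

lemma intervalIntegrable_coord {d : ℕ} (hd : 2 ≤ d) {a b : ℝ} (ha : a ∈ Icc (-1 : ℝ) 1)
    (hb : b ∈ Icc (-1 : ℝ) 1) :
    IntervalIntegrable (fun s : ℝ => (1 - s ^ 2) ^ (((d : ℝ) - 3) / 2)) volume a b := by
  have hd' : (2 : ℝ) ≤ d := by exact_mod_cast hd
  refine IntervalIntegrable.mono_set (intervalIntegrable_one_sub_sq_rpow (by linarith)) ?_
  rw [uIcc_of_le (show (-1 : ℝ) ≤ 1 by norm_num)]
  exact uIcc_subset_Icc ha hb

lemma coordCdf_one {d : ℕ} (hd : 2 ≤ d) : coordCdf d 1 = 1 := c1_mul_integral hd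

lemma coordCdf_sub {d : ℕ} (hd : 2 ≤ d) {a b : ℝ} (ha : a ∈ Icc (-1 : ℝ) 1)
    (hb : b ∈ Icc (-1 : ℝ) 1) :
    coordCdf d b - coordCdf d a = c1 d * ∫ s in a..b, (1 - s ^ 2) ^ (((d : ℝ) - 3) / 2) := by
  have h1 : (-1 : ℝ) ∈ Icc (-1 : ℝ) 1 := by simp
  rw [coordCdf, coordCdf, ← mul_sub, intervalIntegral.integral_interval_sub_left
    (intervalIntegrable_coord hd h1 hb) (intervalIntegrable_coord hd h1 ha)]

lemma monotoneOn_coordCdf {d : ℕ} (hd : 2 ≤ d) : MonotoneOn (coordCdf d) (Icc (-1 : ℝ) 1) := by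
  intro a ha b hb hab
  rw [← sub_nonneg, coordCdf_sub hd ha hb]
  refine mul_nonneg (c1_pos hd).le (intervalIntegral.integral_nonneg hab fun s hs => ?_)
  exact Real.rpow_nonneg (by nlinarith [hs.1, hs.2, ha.1, hb.2]) _

lemma coordCdf_nonneg {d : ℕ} (hd : 2 ≤ d) {h : ℝ} (hh : h ∈ Icc (-1 : ℝ) 1) :
    0 ≤ coordCdf d h := by
  have := monotoneOn_coordCdf hd (by simp) hh hh.1
  simpa [coordCdf] using this

lemma coordCdf_le_one {d : ℕ} (hd : 2 ≤ d) {h : ℝ} (hh : h ∈ Icc (-1 : ℝ) 1) :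
    coordCdf d h ≤ 1 := by
  have := monotoneOn_coordCdf hd hh (by simp) hh.2
  rwa [coordCdf_one hd] at this

lemma continuousOn_coordCdf {d : ℕ} (hd : 2 ≤ d) : ContinuousOn (coordCdf d) (Icc (-1 : ℝ) 1) := by
  have h := intervalIntegrable_coord hd (a := -1) (b := 1) (by simp) (by simp)
  rw [intervalIntegrable_iff_integrableOn_Icc_of_le (by norm_num)] at h
  have := intervalIntegral.continuousOn_primitive_interval (μ := volume) (a := (-1 : ℝ)) (b := 1)
    (by rwa [uIcc_of_le (by norm_num)])
  rw [uIcc_of_le (by norm_num)] at this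
  exact this.const_mul _

lemma intervalIntegrable_height {d : ℕ} (hd : 2 ≤ d) {a b : ℝ} (ha : a ∈ Icc (-1 : ℝ) 1)
    (hb : b ∈ Icc (-1 : ℝ) 1) :
    IntervalIntegrable (fun h : ℝ => (1 - h ^ 2) ^ (((d : ℝ) ^ 2 - 2 * (d : ℝ) - 1) / 2))
      volume a b := by
  have hd' : (2 : ℝ) ≤ d := by exact_mod_cast hd
  refine IntervalIntegrable.mono_set (intervalIntegrable_one_sub_sq_rpow (by nlinarith)) ?_
  rw [uIcc_of_le (show (-1 : ℝ) ≤ 1 by norm_num)]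
  exact uIcc_subset_Icc ha hb

lemma II_eq (n d : ℕ) (a b : ℝ) : II n d a b = ∫ h in a..b,
    (1 - h ^ 2) ^ (((d : ℝ) ^ 2 - 2 * (d : ℝ) - 1) / 2) * coordCdf d h ^ (n - d) := rfl

lemma intervalIntegrable_facet (n : ℕ) {d : ℕ} (hd : 2 ≤ d) {a b : ℝ} (ha : a ∈ Icc (-1 : ℝ) 1)
    (hb : b ∈ Icc (-1 : ℝ) 1) :
    IntervalIntegrable (fun h : ℝ => (1 - h ^ 2) ^ (((d : ℝ) ^ 2 - 2 * (d : ℝ) - 1) / 2) *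
      coordCdf d h ^ (n - d)) volume a b :=
  (intervalIntegrable_height hd ha hb).mul_continuousOn
    (((continuousOn_coordCdf hd).mono (uIcc_subset_Icc ha hb)).pow _)

lemma FF_sub_eq (n : ℕ) {d : ℕ} (hd : 2 ≤ d) {a b : ℝ} (ha : a ∈ Icc (-1 : ℝ) 1)
    (hb : b ∈ Icc (-1 : ℝ) 1) :
    FF n d (-1) 1 - FF n d a b = FF n d (-1) a + FF n d b 1 := by
  have h1 : (-1 : ℝ) ∈ Icc (-1 : ℝ) 1 := by simp
  have h2 : (1 : ℝ) ∈ Icc (-1 : ℝ) 1 := by simp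
  have e1 := intervalIntegral.integral_add_adjacent_intervals
    (intervalIntegrable_facet n hd h1 ha) (intervalIntegrable_facet n hd ha hb)
  have e2 := intervalIntegral.integral_add_adjacent_intervals
    (intervalIntegrable_facet n hd h1 hb) (intervalIntegrable_facet n hd hb h2)
  simp only [FF, II_eq]
  rw [← e2, ← e1]
  ring

lemma FF_nonneg (n : ℕ) {d : ℕ} (hd : 2 ≤ d) {a b : ℝ} (ha : -1 ≤ a) (hab : a ≤ b)
    (hb : b ≤ 1) : 0 ≤ FF n d a b := by
  rw [FF, II_eq]
  refine mul_nonneg (mul_nonneg (by positivity) (c2_pos hd).le)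
    (intervalIntegral.integral_nonneg hab fun s hs => mul_nonneg ?_ (pow_nonneg ?_ _))
  · exact Real.rpow_nonneg (by nlinarith [hs.1, hs.2]) _
  · exact coordCdf_nonneg hd ⟨ha.trans hs.1, hs.2.trans hb⟩

lemma FF_left_le (n : ℕ) {d : ℕ} (hd : 2 ≤ d) {h : ℝ} (hh : h ∈ Icc (-1 : ℝ) 1) :
    FF n d (-1) h ≤ n.choose d * 2 * coordCdf d h ^ (n - d) := by
  have h1 : (-1 : ℝ) ∈ Icc (-1 : ℝ) 1 := by simp
  have hI : II n d (-1) h ≤ (∫ s in (-1 : ℝ)..1,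
      (1 - s ^ 2) ^ (((d : ℝ) ^ 2 - 2 * (d : ℝ) - 1) / 2)) * coordCdf d h ^ (n - d) := by
    calc II n d (-1) h ≤ ∫ s in (-1 : ℝ)..h,
        (1 - s ^ 2) ^ (((d : ℝ) ^ 2 - 2 * (d : ℝ) - 1) / 2) * coordCdf d h ^ (n - d) := by
          rw [II_eq]
          refine intervalIntegral.integral_mono_on hh.1 (intervalIntegrable_facet n hd h1 hh)
            ((intervalIntegrable_height hd h1 hh).mul_const _) fun s hs => ?_
          have hs' : s ∈ Icc (-1 : ℝ) 1 := ⟨hs.1, hs.2.trans hh.2⟩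
          refine mul_le_mul_of_nonneg_left ?_ (Real.rpow_nonneg (by nlinarith [hs'.1, hs'.2]) _)
          exact pow_le_pow_left₀ (coordCdf_nonneg hd hs') (monotoneOn_coordCdf hd hs' hh hs.2) _
      _ ≤ _ := by
          rw [intervalIntegral.integral_mul_const]
          refine mul_le_mul_of_nonneg_right ?_ (pow_nonneg (coordCdf_nonneg hd hh) _)
          refine intervalIntegral.integral_mono_interval le_rfl hh.1 hh.2 ?_
            (intervalIntegrable_height hd h1 (by simp))
          filter_upwards [ae_restrict_mem measurableSet_Ioc] with s hs
          exact Real.rpow_nonneg (by nlinarith [hs.1, hs.2]) _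
  calc FF n d (-1) h ≤ n.choose d * 2 * c2 d * ((∫ s in (-1 : ℝ)..1,
      (1 - s ^ 2) ^ (((d : ℝ) ^ 2 - 2 * (d : ℝ) - 1) / 2)) * coordCdf d h ^ (n - d)) := by
        have := c2_pos hd
        rw [FF]
        gcongr
    _ = n.choose d * 2 * (c2 d * ∫ s in (-1 : ℝ)..1,
      (1 - s ^ 2) ^ (((d : ℝ) ^ 2 - 2 * (d : ℝ) - 1) / 2)) * coordCdf d h ^ (n - d) := by ring
    _ = _ := by rw [c2_mul_integral hd, mul_one]

lemma FF_right_le (n : ℕ) {d : ℕ} (hd : 2 ≤ d) {h : ℝ} (h0 : 0 < h) (h1 : h ≤ 1) :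
    FF n d h 1 ≤ n.choose d * 2 * d *
      ((1 - h ^ 2) ^ (((d : ℝ) - 1) ^ 2 / 2) / (((d : ℝ) - 1) ^ 2 * h)) := by
  have hd' : (2 : ℝ) ≤ d := by exact_mod_cast hd
  have m1 : (1 : ℝ) ∈ Icc (-1 : ℝ) 1 := by simp
  have mh : h ∈ Icc (-1 : ℝ) 1 := ⟨by linarith, h1⟩
  have hI : II n d h 1 ≤ (1 - h ^ 2) ^ (((d : ℝ) - 1) ^ 2 / 2) / (((d : ℝ) - 1) ^ 2 * h) := by
    calc II n d h 1 ≤ ∫ s in h..1, (1 - s ^ 2) ^ (((d : ℝ) ^ 2 - 2 * (d : ℝ) - 1) / 2) := by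
          rw [II_eq]
          refine intervalIntegral.integral_mono_on h1 (intervalIntegrable_facet n hd mh m1)
            (intervalIntegrable_height hd mh m1) fun s hs => ?_
          have hs' : s ∈ Icc (-1 : ℝ) 1 := ⟨mh.1.trans hs.1, hs.2⟩
          refine mul_le_of_le_one_right (Real.rpow_nonneg (by nlinarith [hs'.1, hs'.2]) _) ?_
          exact pow_le_one₀ (coordCdf_nonneg hd hs') (coordCdf_le_one hd hs')
      _ ≤ _ := by
          have := integral_one_sub_sq_rpow_le (x := ((d : ℝ) - 1) ^ 2 / 2)
            (by nlinarith) h0 h1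
          rw [show ((d : ℝ) ^ 2 - 2 * (d : ℝ) - 1) / 2 = ((d : ℝ) - 1) ^ 2 / 2 - 1 by ring]
          rwa [show 2 * (((d : ℝ) - 1) ^ 2 / 2) * h = ((d : ℝ) - 1) ^ 2 * h by ring] at this
  rw [FF]
  have hp : 0 ≤ II n d h 1 := by
    rw [II_eq]
    refine intervalIntegral.integral_nonneg h1 fun s hs => mul_nonneg ?_ (pow_nonneg ?_ _)
    · exact Real.rpow_nonneg (by nlinarith [hs.1, hs.2]) _
    · exact coordCdf_nonneg hd ⟨mh.1.trans hs.1, hs.2⟩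
  have := c2_le hd
  gcongr

lemma choose_le_exp {n d : ℕ} (hd : 0 < d) (hn : 0 < n) :
    (n.choose d : ℝ) ≤ Real.exp (d * (Real.log ((n : ℝ) / d) + 1)) := by
  have hd' : (0 : ℝ) < d := by exact_mod_cast hd
  have hn' : (0 : ℝ) < n := by exact_mod_cast hn
  have h1 : (n.choose d : ℝ) ≤ (n : ℝ) ^ d / d.factorial := Nat.choose_le_pow_div d n
  have h2 := Real.pow_div_factorial_le_exp (d : ℝ) hd'.le d
  have h3 : Real.exp (d * (Real.log ((n : ℝ) / d) + 1)) = ((n : ℝ) / d) ^ d * Real.exp d := by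
    rw [mul_add, mul_one, Real.exp_add, Real.exp_nat_mul, Real.exp_log (by positivity)]
  rw [h3]
  calc (n.choose d : ℝ) ≤ (n : ℝ) ^ d / d.factorial := h1
    _ = ((n : ℝ) / d) ^ d * ((d : ℝ) ^ d / d.factorial) := by
      rw [div_pow]
      field_simp
    _ ≤ _ := by gcongr

lemma FF_upper_heights_le {n d : ℕ} (hd : 2 ≤ d) (hn : d ≤ n) :
    FF n d (√(1 - (Real.exp (-3) * (d : ℝ) / (n : ℝ)) ^
      (2 * ((d : ℝ) + 1) / ((d : ℝ) - 1) ^ 2))) 1 ≤ 2 * ((d : ℝ) / n) := by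
  have hd' : (2 : ℝ) ≤ d := by exact_mod_cast hd
  have hn' : (d : ℝ) ≤ n := by exact_mod_cast hn
  have hn0 : (0 : ℝ) < n := by linarith
  set L := Real.log ((n : ℝ) / d) with hL
  have hL0 : 0 ≤ L := Real.log_nonneg (by rw [le_div_iff₀ (by linarith)]; linarith)
  have hdn : (d : ℝ) / n = Real.exp (-L) := by
    rw [Real.exp_neg, hL, Real.exp_log (by positivity), inv_div]
  have hbase : Real.exp (-3) * (d : ℝ) / n = Real.exp (-(3 + L)) := by
    rw [mul_div_assoc, hdn, ← Real.exp_add]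
    ring_nf
  have hm : (1 : ℝ) ≤ ((d : ℝ) - 1) ^ 2 := by nlinarith
  rw [hbase]
  set ε := Real.exp (-(3 + L)) ^ (2 * ((d : ℝ) + 1) / ((d : ℝ) - 1) ^ 2) with hε
  have hε' : ε = Real.exp (-((3 + L) * (2 * ((d : ℝ) + 1) / ((d : ℝ) - 1) ^ 2))) := by
    rw [hε, ← Real.exp_mul]
    ring_nf
  have hε0 : 0 < ε := by rw [hε']; exact Real.exp_pos _
  have hεd : ε ≤ d / (d + 1) := by
    have h1 : 1 / (d : ℝ) ≤ (3 + L) * (2 * ((d : ℝ) + 1) / ((d : ℝ) - 1) ^ 2) := by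
      calc 1 / (d : ℝ) ≤ 1 * (2 * ((d : ℝ) + 1) / ((d : ℝ) - 1) ^ 2) := by
            rw [one_mul, div_le_div_iff₀ (by linarith) (by linarith)]
            nlinarith
        _ ≤ _ := by
            refine mul_le_mul_of_nonneg_right (by linarith) (by positivity)
    have h2 := Real.add_one_le_exp (1 / (d : ℝ))
    calc ε ≤ Real.exp (-(1 / (d : ℝ))) := by rw [hε']; gcongr
      _ = (Real.exp (1 / (d : ℝ)))⁻¹ := Real.exp_neg _
      _ ≤ (1 / (d : ℝ) + 1)⁻¹ := by gcongr
      _ = d / (d + 1) := by field_simp; ring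
  have h1ε : 1 / (d : ℝ) ^ 2 ≤ 1 - ε := by
    have : 1 / (d : ℝ) ^ 2 ≤ 1 - d / (d + 1) := by
      rw [one_sub_div (by positivity), div_le_div_iff₀ (by positivity) (by positivity)]
      nlinarith
    linarith
  have hh : 1 / (d : ℝ) ≤ √(1 - ε) := by
    apply Real.le_sqrt_of_sq_le
    rwa [div_pow, one_pow]
  have hpos : 0 < √(1 - ε) := lt_of_lt_of_le (by positivity) hh
  have hh1 : √(1 - ε) ≤ 1 := by
    refine Real.sqrt_le_one.2 ?_
    linarith
  have hsq : 1 - √(1 - ε) ^ 2 = ε := by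
    rw [Real.sq_sqrt (le_trans (by positivity) h1ε)]
    ring
  have hpow : ε ^ (((d : ℝ) - 1) ^ 2 / 2) = Real.exp (-((3 + L) * (d + 1))) := by
    rw [hε', ← Real.exp_mul]
    have : (d : ℝ) - 1 ≠ 0 := by linarith
    congr 1
    field_simp
  refine (FF_right_le n hd hpos hh1).trans ?_
  rw [hsq, hpow, hdn]
  have hden : 1 / (d : ℝ) ≤ ((d : ℝ) - 1) ^ 2 * √(1 - ε) := by
    nlinarith
  have hexp : (d : ℝ) ≤ Real.exp d := by linarith [Real.add_one_le_exp (d : ℝ)]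
  calc (n.choose d : ℝ) * 2 * d *
      (Real.exp (-((3 + L) * (d + 1))) / (((d : ℝ) - 1) ^ 2 * √(1 - ε)))
      ≤ Real.exp (d * (L + 1)) * 2 * Real.exp d *
        (Real.exp (-((3 + L) * (d + 1))) / (1 / (d : ℝ))) := by
        gcongr
        exact choose_le_exp (by omega) (by omega)
    _ = 2 * (Real.exp (d * (L + 1)) * Real.exp d * Real.exp (-((3 + L) * (d + 1))) * d) := by
        field_simp
    _ ≤ 2 * (Real.exp (d * (L + 1)) * Real.exp d * Real.exp (-((3 + L) * (d + 1))) *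
        Real.exp d) := by gcongr
    _ = 2 * Real.exp (-L - 3) := by
        simp only [← Real.exp_add]
        ring_nf
    _ ≤ 2 * Real.exp (-L) := by
        gcongr
        linarith

lemma le_one_sub_coordCdf {n d : ℕ} (hd : 2 ≤ d) (hn : 0 < n)
    (hL : 1 ≤ Real.log ((n : ℝ) / d))
    (hB : 100 * Real.log ((n : ℝ) / d) ^ ((3 : ℝ) / 2) ≤ (n : ℝ) / d) :
    8 * (d * Real.log ((n : ℝ) / d)) / n ≤ 1 - coordCdf d (√(1 -
      (100 * (d : ℝ) * Real.log ((n : ℝ) / d) ^ ((3 : ℝ) / 2) / n) ^ (2 / ((d : ℝ) - 1)))) := by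
  have hd' : (2 : ℝ) ≤ d := by exact_mod_cast hd
  have hn0 : (0 : ℝ) < n := by exact_mod_cast hn
  set L := Real.log ((n : ℝ) / d) with hLdef
  have ht : (n : ℝ) / d = Real.exp L := by rw [hLdef, Real.exp_log (by positivity)]
  have hdn : (d : ℝ) / n = Real.exp (-L) := by rw [Real.exp_neg, ← ht, inv_div]
  set l := √L with hl
  have hlL : l ^ 2 = L := Real.sq_sqrt (by linarith)
  have hl1 : 1 ≤ l := by rw [hl, Real.one_le_sqrt]; exact hL
  have hl3 : L ^ ((3 : ℝ) / 2) = l ^ 3 := by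
    rw [hl, Real.sqrt_eq_rpow, ← Real.rpow_natCast, ← Real.rpow_mul (by linarith)]
    norm_num
  rw [hl3] at hB ⊢
  set B := 100 * (d : ℝ) * l ^ 3 / n with hBdef
  have hB0 : 0 < B := by positivity
  have hB1 : B ≤ 1 := by
    rw [le_div_iff₀ (by linarith)] at hB
    rw [hBdef, div_le_one hn0]
    linarith
  have hBL : Real.exp (-L) ≤ B / 2 := by
    rw [← hdn, hBdef]
    have : 1 ≤ l ^ 3 := one_le_pow₀ hl1
    rw [div_div, div_le_div_iff₀ (by positivity) (by positivity)]
    have : (d : ℝ) * n * 1 ≤ d * n * l ^ 3 := by gcongr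
    nlinarith [mul_pos (show (0 : ℝ) < d by linarith) hn0]
  have he : 0 < 2 / ((d : ℝ) - 1) := div_pos two_pos (by linarith)
  set h := √(1 - B ^ (2 / ((d : ℝ) - 1))) with hh
  set k := √(1 - (B / 2) ^ (2 / ((d : ℝ) - 1))) with hk
  have hBp : B ^ (2 / ((d : ℝ) - 1)) ≤ 1 := Real.rpow_le_one hB0.le hB1 he.le
  have hBp2 : (B / 2) ^ (2 / ((d : ℝ) - 1)) < 1 :=
    Real.rpow_lt_one (by linarith) (by linarith) he
  have hBp3 : (B / 2) ^ (2 / ((d : ℝ) - 1)) ≤ B ^ (2 / ((d : ℝ) - 1)) :=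
    Real.rpow_le_rpow (by linarith) (by linarith) he.le
  have hBp4 : 0 < (B / 2) ^ (2 / ((d : ℝ) - 1)) := Real.rpow_pos_of_pos (by linarith) _
  have h0 : 0 ≤ h := Real.sqrt_nonneg _
  have hhk : h ≤ k := Real.sqrt_le_sqrt (by linarith)
  have hk0 : 0 < k := Real.sqrt_pos.2 (by linarith)
  have hk1 : k ≤ 1 := by
    rw [hk, Real.sqrt_le_one]
    linarith
  have hx : 0 < ((d : ℝ) - 1) / 2 := by linarith
  have hxe : 2 / ((d : ℝ) - 1) * (((d : ℝ) - 1) / 2) = 1 := by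
    have : (d : ℝ) - 1 ≠ 0 := by linarith
    field_simp
  have hhx : (1 - h ^ 2) ^ (((d : ℝ) - 1) / 2) = B := by
    rw [hh, Real.sq_sqrt (by linarith), sub_sub_cancel, ← Real.rpow_mul hB0.le, hxe,
      Real.rpow_one]
  have hkx : (1 - k ^ 2) ^ (((d : ℝ) - 1) / 2) = B / 2 := by
    rw [hk, Real.sq_sqrt (by linarith), sub_sub_cancel, ← Real.rpow_mul (by linarith), hxe,
      Real.rpow_one]
  have hmem : h ∈ Icc (-1 : ℝ) 1 := ⟨by linarith, hhk.trans hk1⟩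
  set q := √((d : ℝ) - 1) with hq
  have hqd : q ^ 2 = (d : ℝ) - 1 := Real.sq_sqrt (by linarith)
  have hq0 : 0 < q := Real.sqrt_pos.2 (by linarith)
  have hkq : k * q ≤ 3 / 2 * l := by
    have h1 : 1 - L * (2 / ((d : ℝ) - 1)) ≤ (B / 2) ^ (2 / ((d : ℝ) - 1)) := by
      calc 1 - L * (2 / ((d : ℝ) - 1)) ≤ Real.exp (-L * (2 / ((d : ℝ) - 1))) := by
            linarith [Real.add_one_le_exp (-L * (2 / ((d : ℝ) - 1)))]
        _ = Real.exp (-L) ^ (2 / ((d : ℝ) - 1)) := Real.exp_mul _ _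
        _ ≤ _ := Real.rpow_le_rpow (Real.exp_pos _).le hBL he.le
    have h2 : k ^ 2 ≤ L * (2 / ((d : ℝ) - 1)) := by
      rw [hk, Real.sq_sqrt (by linarith)]
      linarith
    refine abs_le_of_sq_le_sq' ?_ (by linarith) |>.2
    calc (k * q) ^ 2 = k ^ 2 * ((d : ℝ) - 1) := by rw [mul_pow, hqd]
      _ ≤ L * (2 / ((d : ℝ) - 1)) * ((d : ℝ) - 1) := by
        refine mul_le_mul_of_nonneg_right h2 (by linarith)
      _ = 2 * l ^ 2 := by
        have : (d : ℝ) - 1 ≠ 0 := by linarith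
        rw [hlL]
        field_simp
      _ ≤ (3 / 2 * l) ^ 2 := by nlinarith
  have h1 := le_integral_one_sub_sq_rpow hx h0 hhk hk0 hk1
  rw [hhx, hkx, show ((d : ℝ) - 1) / 2 - 1 = ((d : ℝ) - 3) / 2 by ring] at h1
  have h2 := coordCdf_sub hd hmem (by simp : (1 : ℝ) ∈ Icc (-1 : ℝ) 1)
  rw [coordCdf_one hd] at h2
  rw [h2]
  calc 8 * (d * L) / n ≤ 100 * (d * L) / (12 * n) := by
        rw [div_le_div_iff₀ hn0 (by positivity)]
        have : 0 ≤ d * L * n := by positivity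
        nlinarith
    _ = B / (8 * (3 / 2 * l)) := by
        rw [hBdef, ← hlL, div_div, div_eq_div_iff (by positivity) (by positivity)]
        ring
    _ ≤ B / (8 * (k * q)) := by gcongr
    _ = q / 4 * ((B - B / 2) / (2 * (((d : ℝ) - 1) / 2) * k)) := by
        rw [← hqd, show 2 * (q ^ 2 / 2) * k = q * (k * q) by ring, ← mul_div_mul_comm,
          div_eq_div_iff (by positivity) (by positivity)]
        ring
    _ ≤ _ := by
        have hB2 : 0 ≤ B - B / 2 := by linarith
        have := sqrt_le_c1 hd
        have := c1_pos hd
        gcongr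

lemma FF_lower_heights_le {n d : ℕ} (hd : 2 ≤ d) (hn : 0 < n)
    (hL : 1 ≤ Real.log ((n : ℝ) / d))
    (hB : 100 * Real.log ((n : ℝ) / d) ^ ((3 : ℝ) / 2) ≤ (n : ℝ) / d) :
    FF n d (-1) (√(1 - (100 * (d : ℝ) * Real.log ((n : ℝ) / d) ^ ((3 : ℝ) / 2) / n) ^
      (2 / ((d : ℝ) - 1)))) ≤ 2 * ((d : ℝ) / n) := by
  have hd' : (2 : ℝ) ≤ d := by exact_mod_cast hd
  have hn0 : (0 : ℝ) < n := by exact_mod_cast hn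
  set L := Real.log ((n : ℝ) / d) with hLdef
  have ht : (n : ℝ) / d = Real.exp L := by rw [hLdef, Real.exp_log (by positivity)]
  have hdn : (d : ℝ) / n = Real.exp (-L) := by rw [Real.exp_neg, ← ht, inv_div]
  have h2d : 2 * (d : ℝ) ≤ n := by
    have := Real.add_one_le_exp L
    rw [← le_div_iff₀ (by linarith), ht]
    linarith
  set h := √(1 - (100 * (d : ℝ) * L ^ ((3 : ℝ) / 2) / n) ^ (2 / ((d : ℝ) - 1))) with hh
  have hmem : h ∈ Icc (-1 : ℝ) 1 := by
    refine ⟨by linarith [Real.sqrt_nonneg (1 - (100 * (d : ℝ) * L ^ ((3 : ℝ) / 2) / n) ^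
      (2 / ((d : ℝ) - 1)))], Real.sqrt_le_one.2 ?_⟩
    have : 0 ≤ (100 * (d : ℝ) * L ^ ((3 : ℝ) / 2) / n) ^ (2 / ((d : ℝ) - 1)) := by positivity
    linarith
  have htail : 8 * (d * L) / n ≤ 1 - coordCdf d h := le_one_sub_coordCdf hd hn hL hB
  have hpow : coordCdf d h ^ (n - d) ≤ Real.exp (-(4 * (d * L))) := by
    have h1 : coordCdf d h ≤ Real.exp (-(8 * (d * L) / n)) := by
      linarith [Real.add_one_le_exp (-(8 * (d * L) / n))]
    calc coordCdf d h ^ (n - d) ≤ Real.exp (-(8 * (d * L) / n)) ^ (n - d) :=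
          pow_le_pow_left₀ (coordCdf_nonneg hd hmem) h1 _
      _ = Real.exp (((n - d : ℕ) : ℝ) * -(8 * (d * L) / n)) := (Real.exp_nat_mul _ _).symm
      _ ≤ _ := by
          have hle : d ≤ n := by
            have : (d : ℝ) ≤ n := by linarith
            exact_mod_cast this
          rw [Nat.cast_sub hle]
          gcongr
          have : (n : ℝ) / 2 * (8 * (d * L) / n) ≤ (n - d) * (8 * (d * L) / n) := by
            gcongr
            linarith
          have h3 : (n : ℝ) / 2 * (8 * (d * L) / n) = 4 * (d * L) := by
            field_simp
            norm_num
          linarith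
  rw [hdn]
  calc FF n d (-1) h ≤ n.choose d * 2 * coordCdf d h ^ (n - d) := FF_left_le n hd hmem
    _ ≤ Real.exp (d * (L + 1)) * 2 * Real.exp (-(4 * (d * L))) := by
        gcongr
        · exact pow_nonneg (coordCdf_nonneg hd hmem) _
        · exact choose_le_exp (by omega) hn
    _ = 2 * Real.exp (d * (1 - 3 * L)) := by
        rw [mul_right_comm, ← Real.exp_add, mul_comm]
        ring_nf
    _ ≤ 2 * Real.exp (-L) := by
        gcongr
        nlinarith

/-- in the fast regime `d/n → 0`, there are constants `r₁` (large) and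
`r₂` (small) such that all facets have heights in `[h₁, h₂]` with
`h₁ = √(1-(r₁ d (ln(n/d))^{3/2}/n)^{2/(d-1)})` and `h₂ = √(1-(r₂ d/n)^{2(d+1)/(d-1)²})`. -/
theorem facet_range_fast (d : ℕ → ℕ)
    (hd : ∀ᶠ n in atTop, 2 ≤ d n ∧ d n < n)
    (hdn : Tendsto (fun n : ℕ => (d n : ℝ) / (n : ℝ)) atTop (nhds 0)) :
    ∃ r₁ : ℝ, 0 < r₁ ∧ ∃ r₂ : ℝ, 0 < r₂ ∧
      (Tendsto (fun n : ℕ => FF n (d n) (-1)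
          (Real.sqrt (1 - (r₁ * (d n : ℝ) * (Real.log ((n : ℝ) / (d n : ℝ))) ^ ((3 : ℝ) / 2) /
            (n : ℝ)) ^ (2 / ((d n : ℝ) - 1))))) atTop (nhds 0)) ∧
      (Tendsto (fun n : ℕ => FF n (d n)
          (Real.sqrt (1 - (r₂ * (d n : ℝ) / (n : ℝ)) ^
            (2 * ((d n : ℝ) + 1) / ((d n : ℝ) - 1) ^ 2))) 1) atTop (nhds 0)) ∧
      (Tendsto (fun n : ℕ => FF n (d n) (-1) 1 -
          FF n (d n)
            (Real.sqrt (1 - (r₁ * (d n : ℝ) * (Real.log ((n : ℝ) / (d n : ℝ))) ^ ((3 : ℝ) / 2) /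
              (n : ℝ)) ^ (2 / ((d n : ℝ) - 1))))
            (Real.sqrt (1 - (r₂ * (d n : ℝ) / (n : ℝ)) ^
              (2 * ((d n : ℝ) + 1) / ((d n : ℝ) - 1) ^ 2)))) atTop (nhds 0)) := by
  have hinv : Tendsto (fun n : ℕ => (n : ℝ) / (d n : ℝ)) atTop atTop := by
    have hpos : Tendsto (fun n : ℕ => (d n : ℝ) / (n : ℝ)) atTop (nhdsWithin 0 (Ioi 0)) := by
      refine tendsto_nhdsWithin_iff.2 ⟨hdn, ?_⟩
      filter_upwards [hd] with n hn
      have h1 : (0 : ℝ) < d n := by exact_mod_cast (by omega : 0 < d n)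
      have h2 : (0 : ℝ) < n := by exact_mod_cast (by omega : 0 < n)
      exact div_pos h1 h2
    refine hpos.inv_tendsto_nhdsGT_zero.congr fun n => ?_
    simp
  have hlog := (Real.tendsto_log_atTop.comp hinv).eventually_ge_atTop 1
  have hB := hinv.eventually ((isLittleO_log_rpow_rpow_atTop ((3 : ℝ) / 2) one_pos).bound
    (by norm_num : (0 : ℝ) < 1 / 100))
  have hlim : Tendsto (fun n : ℕ => 2 * ((d n : ℝ) / (n : ℝ))) atTop (nhds 0) := by
    simpa using hdn.const_mul 2
  have hmem : ∀ x : ℝ, 0 ≤ x → √(1 - x) ∈ Icc (-1 : ℝ) 1 := fun x hx =>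
    ⟨by linarith [Real.sqrt_nonneg (1 - x)], Real.sqrt_le_one.2 (by linarith)⟩
  have hx₁ : ∀ᶠ n : ℕ in atTop, 0 ≤ (100 * (d n : ℝ) *
      (Real.log ((n : ℝ) / (d n : ℝ))) ^ ((3 : ℝ) / 2) / (n : ℝ)) ^ (2 / ((d n : ℝ) - 1)) := by
    filter_upwards [hlog] with n hL
    simp only [Function.comp_apply] at hL
    positivity
  have hx₂ : ∀ n : ℕ, 0 ≤ (Real.exp (-3) * (d n : ℝ) / (n : ℝ)) ^
      (2 * ((d n : ℝ) + 1) / ((d n : ℝ) - 1) ^ 2) := fun n => by positivity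
  have hlower : Tendsto (fun n : ℕ => FF n (d n) (-1)
      (√(1 - (100 * (d n : ℝ) * (Real.log ((n : ℝ) / (d n : ℝ))) ^ ((3 : ℝ) / 2) /
        (n : ℝ)) ^ (2 / ((d n : ℝ) - 1))))) atTop (nhds 0) := by
    refine tendsto_of_tendsto_of_tendsto_of_le_of_le' tendsto_const_nhds hlim ?_ ?_
    · filter_upwards [hd, hx₁] with n hn hx
      exact FF_nonneg n hn.1 le_rfl (hmem _ hx).1 (hmem _ hx).2
    · filter_upwards [hd, hlog, hB] with n hn hL hb
      simp only [Function.comp_apply] at hL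
      refine FF_lower_heights_le hn.1 (by omega) hL ?_
      rw [Real.rpow_one, Real.norm_of_nonneg (by positivity), Real.norm_of_nonneg (by positivity)]
        at hb
      linarith
  have hupper : Tendsto (fun n : ℕ => FF n (d n)
      (√(1 - (Real.exp (-3) * (d n : ℝ) / (n : ℝ)) ^
        (2 * ((d n : ℝ) + 1) / ((d n : ℝ) - 1) ^ 2))) 1) atTop (nhds 0) := by
    refine tendsto_of_tendsto_of_tendsto_of_le_of_le' tendsto_const_nhds hlim ?_ ?_
    · filter_upwards [hd] with n hn
      exact FF_nonneg n hn.1 (hmem _ (hx₂ n)).1 (hmem _ (hx₂ n)).2 le_rfl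
    · filter_upwards [hd] with n hn
      exact FF_upper_heights_le hn.1 hn.2.le
  refine ⟨100, by norm_num, Real.exp (-3), Real.exp_pos _, hlower, hupper, ?_⟩
  have hsum := hlower.add hupper
  rw [add_zero] at hsum
  refine hsum.congr' ?_
  filter_upwards [hd, hx₁] with n hn hx
  exact (FF_sub_eq n hn.1 (hmem _ hx) (hmem _ (hx₂ n))).symm
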